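/- For any rooted tree t, Σ_{t ⊲ t'} n(t;t')·m(t;t') − Σ_{t'' ⊲ t} n(t'';t)·m(t'';t) = |t|, where the first sum is over isomorphism classes of rooted trees t' covering t and the second over isomorphism classes of rooted trees t'' covered by t. -/

import Mathlib

attribute [local instance] Classical.propDecidable

inductive PlanarTree : Type where
  | node : List PlanarTree → PlanarTree

namespace PlanarTree

/-- Isomorphism of (planar representatives of) rooted trees: the lists of
principal branches match up, pairwise isomorphically, after a permutation. -/
inductive Iso : PlanarTree → PlanarTree → Prop where
  | node {l m l' : List PlanarTree} :
      List.Perm l m → List.Forall₂ Iso m l' → Iso (node l) (node l')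

/-- Number of vertices. -/
def size : PlanarTree → ℕ
  | node l => 1 + (l.attach.map fun c => size c.1).sum
decreasing_by simp only [PlanarTree.node.sizeOf_spec]; exact Nat.lt_of_lt_of_le (List.sizeOf_lt_of_mem c.2) (Nat.le_add_left _ _)

mutual
  /-- All trees obtained by attaching the root of `s` by a new edge to some vertex. -/
  def graftList (s : PlanarTree) : PlanarTree → List PlanarTree
    | node l => node (s :: l) :: (graftAux s l).map node
  def graftAux (s : PlanarTree) : List PlanarTree → List (List PlanarTree)
    | [] => []
    | a :: l => ((graftList s a).map (· :: l)) ++ (graftAux s l).map (a :: ·)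
end

/-- All trees obtained by adding a new edge and terminal vertex at some vertex. -/
def growList (t : PlanarTree) : List PlanarTree := graftList (node []) t

mutual
  /-- All trees obtained by deleting one (non-root) terminal vertex. -/
  def pruneList : PlanarTree → List PlanarTree
    | node l => (pruneAux l).map node
  def pruneAux : List PlanarTree → List (List PlanarTree)
    | [] => []
    | a :: l =>
        (match a with | node [] => [l] | _ => []) ++
        ((pruneList a).map (· :: l)) ++ (pruneAux l).map (a :: ·)
end

mutual
  /-- All pairs (cut-off subtree, remaining tree) obtained by cutting one edge. -/
  def cutPairs : PlanarTree → List (PlanarTree × PlanarTree)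
    | node l => (cutAux l).map fun x => (x.1, node x.2)
  def cutAux : List PlanarTree → List (PlanarTree × List PlanarTree)
    | [] => []
    | a :: l =>
        (a, l) :: (((cutPairs a).map fun x => (x.1, x.2 :: l)) ++
          (cutAux l).map fun x => (x.1, a :: x.2))
end

/-- The order of the symmetry group `SG(t)`: the product over all vertices `v`
of the number of permutations of the branches at `v` exchanging isomorphic branches. -/
noncomputable def sg : PlanarTree → ℕ
  | node l =>
      (l.attach.map fun c => sg c.1).prod *
        Nat.card {σ : Equiv.Perm (Fin l.length) // ∀ i, Iso (l.get (σ i)) (l.get i)}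
decreasing_by simp only [PlanarTree.node.sizeOf_spec]; exact Nat.lt_of_lt_of_le (List.sizeOf_lt_of_mem c.2) (Nat.le_add_left _ _)

/-- Vertices of a planar tree, encoded as paths of child-indices from the root. -/
inductive IsVertex : PlanarTree → List ℕ → Prop where
  | root (t : PlanarTree) : IsVertex t []
  | child {l : List PlanarTree} {i : ℕ} {c : PlanarTree} {p : List ℕ} :
      l[i]? = some c → IsVertex c p → IsVertex (node l) (i :: p)

def Vertex (t : PlanarTree) : Type := {p : List ℕ // IsVertex t p}

/-- `v` lies strictly below `w` in the tree order (i.e. `w` is a proper ancestor of `v`). -/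
def StrictBelow {t : PlanarTree} (v w : Vertex t) : Prop := w.1 <+: v.1 ∧ w.1 ≠ v.1

/-- A labelling of `t`. -/
def Labelling (t : PlanarTree) : Type :=
  {f : Vertex t ≃ Fin t.size // ∀ v w, StrictBelow v w → f w < f v}

/-- Equivalence of labellings: they differ by an automorphism of the rooted tree. -/
def labelEquiv {t : PlanarTree} (f g : Labelling t) : Prop :=
  ∃ φ : Equiv.Perm (Vertex t),
    (∀ v w, StrictBelow (φ v) (φ w) ↔ StrictBelow v w) ∧ ∀ v, f.1 (φ v) = g.1 v

end PlanarTree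

/-- Rooted trees: isomorphism classes of planar rooted trees. -/
instance planarSetoid : Setoid PlanarTree := Relation.EqvGen.setoid PlanarTree.Iso

def RTree : Type := Quotient planarSetoid

namespace RTree

def mk (p : PlanarTree) : RTree := ⟦p⟧

/-- A chosen planar representative. -/
noncomputable def rep (T : RTree) : PlanarTree := Quotient.out T

noncomputable def size (T : RTree) : ℕ := T.rep.size

/-- The order of the symmetry (automorphism) group of `T`. -/
noncomputable def sg (T : RTree) : ℕ := T.rep.sg

/-- The one-vertex tree. -/
def bullet : RTree := mk (PlanarTree.node [])

/-- `Covers T T'` means `T ⊲ T'`: `T` is obtained from `T'` by deleting one terminal vertex. -/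
noncomputable def Covers (T T' : RTree) : Prop :=
  ∃ p ∈ T'.rep.pruneList, mk p = T

/-- `n(T;T')`: the number of vertices of `T` to which a new edge can be added to obtain `T'`. -/
noncomputable def nCov (T T' : RTree) : ℕ :=
  T.rep.growList.countP fun p => decide (mk p = T')

/-- `m(T;T')`: the number of (terminal) edges of `T'` which when removed leave `T`. -/
noncomputable def mCov (T T' : RTree) : ℕ :=
  T'.rep.pruneList.countP fun p => decide (mk p = T)

/-- `n(T₁,T₂;T₃)`: the number of vertices of `T₂` such that attaching the root of `T₁`
there by a new edge yields `T₃`. -/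
noncomputable def nTri (T₁ T₂ T₃ : RTree) : ℕ :=
  (PlanarTree.graftList T₁.rep T₂.rep).countP fun p => decide (mk p = T₃)

/-- `m(T₁,T₂;T₃)`: the number of edges of `T₃` whose removal cuts off a subtree
isomorphic to `T₁` leaving `T₂` (the piece containing the root). -/
noncomputable def mTri (T₁ T₂ T₃ : RTree) : ℕ :=
  T₃.rep.cutPairs.countP fun x => decide (mk x.1 = T₁ ∧ mk x.2 = T₂)

end RTree

section Ops

variable (k : Type*) [Semiring k]

/-- The element `𝔑(T) = Σ_{T ⊲ T'} n(T;T')·T'` of `k{T}`. -/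
noncomputable def growF (T : RTree) : RTree →₀ k :=
  (T.rep.growList.map fun p => Finsupp.single (RTree.mk p) (1 : k)).sum

/-- The element `𝔓(T) = Σ_{T' ⊲ T} m(T';T)·T'` of `k{T}`. -/
noncomputable def pruneF (T : RTree) : RTree →₀ k :=
  (T.rep.pruneList.map fun p => Finsupp.single (RTree.mk p) (1 : k)).sum

/-- The growth operator `𝔑` on `k{T}`. -/
noncomputable def Grow : Module.End k (RTree →₀ k) :=
  Finsupp.linearCombination k (growF k)

/-- The pruning operator `𝔓` on `k{T}`. -/
noncomputable def Prune : Module.End k (RTree →₀ k) :=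
  Finsupp.linearCombination k (pruneF k)

/-- The operator `𝔇` on `k{T}`, `𝔇(t) = |t|·t`. -/
noncomputable def Diag : Module.End k (RTree →₀ k) :=
  Finsupp.linearCombination k fun T => (T.size : k) • Finsupp.single T 1

/-- The inner product on `k{T}` determined by `(t,t') = |SG(t)|·δ_{t,t'}`. -/
noncomputable def innerT (x y : RTree →₀ k) : k :=
  x.sum fun T c => c * y T * (T.sg : k)

/-- Generalized multiplicity `n(T;T')`: coefficient of `T'` in `𝔑^{|T'|-|T|}(T)`. -/
noncomputable def nGen (T T' : RTree) : k :=
  ((Grow k ^ (T'.size - T.size)) (Finsupp.single T 1)) T'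

/-- Generalized multiplicity `m(T;T')`: coefficient of `T` in `𝔓^{|T'|-|T|}(T')`. -/
noncomputable def mGen (T T' : RTree) : k :=
  ((Prune k ^ (T'.size - T.size)) (Finsupp.single T' 1)) T

end Ops

section Kreimer

variable (k : Type*) [CommSemiring k]

/-- Kreimer's Hopf algebra `H_K`, as a commutative algebra: the free polynomial
algebra on rooted trees. -/
abbrev HK := MvPolynomial RTree k

/-- The inclusion `k{T} → H_K` of the linear span of the variables. -/
noncomputable def toHK : (RTree →₀ k) →ₗ[k] HK k :=
  Finsupp.linearCombination k fun T => MvPolynomial.X T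

/-- The growth derivation `N` on `H_K`, with `N(t) = 𝔑(t)` for rooted trees `t`. -/
noncomputable def ND : Derivation k (HK k) (HK k) :=
  MvPolynomial.mkDerivation k fun T => toHK k (growF k T)

/-- The pruning derivation `P` on `H_K`, with `P(t) = 𝔓(t)` for `|t| ≥ 2`, `P(•) = 1`. -/
noncomputable def PD : Derivation k (HK k) (HK k) :=
  MvPolynomial.mkDerivation k fun T =>
    if T = RTree.bullet then 1 else toHK k (pruneF k T)

/-- The grading derivation `D` on `H_K`, multiplying each homogeneous element of
degree `n` by `n`; it is the derivation with `D(t) = |t|·t` for rooted trees `t`. -/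
noncomputable def DD : Derivation k (HK k) (HK k) :=
  MvPolynomial.mkDerivation k fun T => (T.size : k) • MvPolynomial.X T

/-- The map `B₊ : H_K → k{T}` sending a forest to the tree obtained by attaching
all its roots to a new root vertex. -/
noncomputable def forestTree (d : RTree →₀ ℕ) : RTree :=
  RTree.mk (PlanarTree.node
    (d.support.toList.flatMap fun T => List.replicate (d T) T.rep))

noncomputable def Bplus (p : HK k) : RTree →₀ k :=
  ∑ d ∈ p.support, Finsupp.single (forestTree d) (MvPolynomial.coeff d p)

/-- The inner product on `H_K`. -/
noncomputable def innerHK (u v : HK k) : k := innerT k (Bplus k u) (Bplus k v)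

/-- The degree-`n` homogeneous component of `H_K`. -/
noncomputable abbrev HKcomp (n : ℕ) : Submodule k (HK k) :=
  MvPolynomial.weightedHomogeneousSubmodule k (fun T : RTree => T.size) n

/-- `T_i`: the number of rooted trees with `i+1` vertices. -/
noncomputable def Tcard (i : ℕ) : ℕ := Nat.card {T : RTree // T.size = i + 1}

end Kreimer

namespace PlanarTree

theorem induction_on_branches {motive : PlanarTree → Prop}
    (node : ∀ l, (∀ a ∈ l, motive a) → motive (.node l)) : ∀ t, motive t
  | .node l => node l fun a _ => induction_on_branches node a
decreasing_by
  simp only [PlanarTree.node.sizeOf_spec]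
  have := List.sizeOf_lt_of_mem ‹a ∈ l›
  omega

theorem Iso.refl (t : PlanarTree) : Iso t t := by
  induction t using induction_on_branches with
  | node l ih => exact .node (.refl l) (List.forall₂_same.2 ih)

theorem Iso.eq_leaf_iff {a b : PlanarTree} (h : Iso a b) : a = .node [] ↔ b = .node [] := by
  obtain ⟨hp, hf⟩ := h
  rw [node.injEq, node.injEq, ← List.length_eq_zero_iff, ← List.length_eq_zero_iff,
    hp.length_eq, hf.length_eq]

theorem mk_eq_of_iso {a b : PlanarTree} (h : Iso a b) : RTree.mk a = RTree.mk b :=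
  Quotient.sound (Relation.EqvGen.rel _ _ h)

theorem apply_eq_of_mk_eq {β : Type*} {φ : PlanarTree → β} (h : ∀ a b, Iso a b → φ a = φ b)
    {a b : PlanarTree} (hab : RTree.mk a = RTree.mk b) : φ a = φ b := by
  have hgen : Relation.EqvGen Iso a b := Quotient.exact hab
  clear hab
  induction hgen with
  | rel a b hab => exact h a b hab
  | refl => rfl
  | symm _ _ _ ih => exact ih.symm
  | trans _ _ _ _ _ ih₁ ih₂ => exact ih₁.trans ih₂

theorem mk_node_replace (k l : List PlanarTree) {a b : PlanarTree} (h : RTree.mk a = RTree.mk b) :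
    RTree.mk (node (k ++ a :: l)) = RTree.mk (node (k ++ b :: l)) := by
  refine apply_eq_of_mk_eq (φ := fun x => RTree.mk (node (k ++ x :: l))) (fun a b hab => ?_) h
  refine mk_eq_of_iso (.node (.refl _) (List.rel_append ?_ (.cons hab ?_))) <;>
    exact List.forall₂_same.2 fun x _ => Iso.refl x

theorem mk_node_map_rep (k l : List PlanarTree) :
    RTree.mk (node (k ++ (l.map RTree.mk).map RTree.rep)) = RTree.mk (node (k ++ l)) := by
  induction l generalizing k with
  | nil => rfl
  | cons a l ih =>
    have h := ih (k ++ [a])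
    simp only [List.append_assoc, List.singleton_append] at h
    rw [← h]
    exact mk_node_replace _ _ (Quotient.out_eq _)

theorem mk_node_congr {l m : List PlanarTree} (h : (l.map RTree.mk).Perm (m.map RTree.mk)) :
    RTree.mk (node l) = RTree.mk (node m) := by
  have hl := mk_node_map_rep [] l
  have hm := mk_node_map_rep [] m
  rw [List.nil_append, List.nil_append] at hl hm
  rw [← hl, ← hm]
  exact mk_eq_of_iso (.node (h.map _) (List.forall₂_same.2 fun x _ => Iso.refl x))

/-- `f` only depends on the isomorphism class of a tree. -/
def TreeInvariant (f : PlanarTree → ℕ) : Prop :=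
  ∀ a b, RTree.mk a = RTree.mk b → f a = f b

/-- `F` only depends on the multiset of isomorphism classes of a list of trees. -/
def ForestInvariant (F : List PlanarTree → ℕ) : Prop :=
  ∀ l m, (l.map RTree.mk).Perm (m.map RTree.mk) → F l = F m

theorem TreeInvariant.node {f : PlanarTree → ℕ} (h : TreeInvariant f) :
    ForestInvariant fun l => f (node l) :=
  fun _ _ hlm => h _ _ (mk_node_congr hlm)

theorem ForestInvariant.cons {F : List PlanarTree → ℕ} (h : ForestInvariant F) (a : PlanarTree) :
    ForestInvariant fun l => F (a :: l) :=
  fun _ _ hlm => h _ _ (hlm.cons _)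

theorem ForestInvariant.head {F : List PlanarTree → ℕ} (h : ForestInvariant F)
    (l : List PlanarTree) : TreeInvariant fun a => F (a :: l) := by
  intro a b hab
  refine h _ _ ?_
  rw [List.map_cons, List.map_cons, hab]

/-- The sum of `F` over all lists obtained by either replacing an entry `a` by a member of `op a`,
or deleting an entry `a`, the latter counted `d a` times. -/
def modifySum (d : PlanarTree → ℕ) (op : PlanarTree → List PlanarTree) :
    List PlanarTree → (List PlanarTree → ℕ) → ℕ
  | [], _ => 0
  | a :: l, F =>
    d a * F l + ((op a).map fun x => F (x :: l)).sum + modifySum d op l fun m => F (a :: m)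

section modifySum

variable {d : PlanarTree → ℕ} {op : PlanarTree → List PlanarTree}

theorem modifySum_perm {l m : List PlanarTree} (h : l.Perm m) {F : List PlanarTree → ℕ}
    (hF : ForestInvariant F) : modifySum d op l F = modifySum d op m F := by
  induction h generalizing F with
  | nil => rfl
  | cons a h ih =>
    simp only [modifySum]
    rw [ih (hF.cons a), hF _ _ (h.map _)]
    simp only [hF _ _ ((h.cons _).map _)]
  | swap a b l =>
    simp only [modifySum]
    have hs : ∀ x y k, F (x :: y :: k) = F (y :: x :: k) :=
      fun x y k => hF _ _ ((List.Perm.swap y x k).map _)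
    simp only [hs b]
    simp only [hs a]
    ring
  | trans _ _ ih₁ ih₂ => exact (ih₁ hF).trans (ih₂ hF)

theorem modifySum_forall₂ {l m : List PlanarTree}
    (h : List.Forall₂ (fun a b => RTree.mk a = RTree.mk b ∧ d a = d b ∧
      ∀ f, TreeInvariant f → ((op a).map f).sum = ((op b).map f).sum) l m)
    {F : List PlanarTree → ℕ} (hF : ForestInvariant F) :
    modifySum d op l F = modifySum d op m F := by
  induction h generalizing F with
  | nil => rfl
  | @cons a b l m hab h ih =>
    obtain ⟨hmk, hd, hop⟩ := hab
    have hlm : l.map RTree.mk = m.map RTree.mk := by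
      rw [← List.forall₂_eq_eq_eq, List.forall₂_map_left_iff, List.forall₂_map_right_iff]
      exact h.imp fun _ _ h => h.1
    have htail : ∀ x, F (x :: l) = F (x :: m) := fun x => hF _ _ (by simp [hlm])
    have hhead : ∀ k, F (a :: k) = F (b :: k) := fun k => hF _ _ (by simp [hmk])
    simp only [modifySum, hhead, htail]
    rw [ih (hF.cons b), hd, hop _ (hF.head m), hF l m (by rw [hlm])]

end modifySum

theorem sum_pruneAux (l : List PlanarTree) (F : List PlanarTree → ℕ) :
    ((pruneAux l).map F).sum =
      modifySum (fun a => if a = node [] then 1 else 0) pruneList l F := by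
  induction l generalizing F with
  | nil => simp [pruneAux, modifySum]
  | cons a l ih =>
    obtain ⟨_ | ⟨b, k⟩⟩ := a <;>
      simp [pruneAux, modifySum, ← ih, Function.comp_def, add_assoc]

theorem sum_graftAux (s : PlanarTree) (l : List PlanarTree) (F : List PlanarTree → ℕ) :
    ((graftAux s l).map F).sum = modifySum (fun _ => 0) (graftList s) l F := by
  induction l generalizing F with
  | nil => simp [graftAux, modifySum]
  | cons a l ih => simp [graftAux, modifySum, ← ih, Function.comp_def]

theorem sum_pruneList_node (l : List PlanarTree) (f : PlanarTree → ℕ) :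
    ((pruneList (node l)).map f).sum = ((pruneAux l).map fun m => f (node m)).sum := by
  simp [pruneList, Function.comp_def]

theorem sum_graftList_node (s : PlanarTree) (l : List PlanarTree) (f : PlanarTree → ℕ) :
    ((graftList s (node l)).map f).sum =
      f (node (s :: l)) + ((graftAux s l).map fun m => f (node m)).sum := by
  simp [graftList, Function.comp_def]

theorem Iso.sum_pruneList {a b : PlanarTree} (h : Iso a b) {f : PlanarTree → ℕ}
    (hf : TreeInvariant f) : ((pruneList a).map f).sum = ((pruneList b).map f).sum := by
  induction a using induction_on_branches generalizing b f with
  | node l ih =>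
    obtain ⟨hp, hm⟩ := h
    rw [sum_pruneList_node, sum_pruneList_node, sum_pruneAux, sum_pruneAux,
      modifySum_perm hp hf.node]
    refine modifySum_forall₂ ?_ hf.node
    refine List.Forall₂.imp ?_ ((List.forall₂_and_left (p := fun a => a ∈ l) _ _).2
      ⟨fun a ha => hp.mem_iff.2 ha, hm⟩)
    exact fun x y ⟨hx, hxy⟩ =>
      ⟨mk_eq_of_iso hxy, by simp only [hxy.eq_leaf_iff], fun _ => ih x hx hxy⟩

theorem Iso.sum_graftList (s : PlanarTree) {a b : PlanarTree} (h : Iso a b) {f : PlanarTree → ℕ}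
    (hf : TreeInvariant f) : ((graftList s a).map f).sum = ((graftList s b).map f).sum := by
  induction a using induction_on_branches generalizing b f with
  | node l ih =>
    have hroot := fun k => hf (.node (s :: l)) (.node (s :: k))
    obtain ⟨hp, hm⟩ := h
    rw [sum_graftList_node, sum_graftList_node, sum_graftAux, sum_graftAux,
      modifySum_perm hp hf.node]
    congr 1
    · exact hroot _ (mk_eq_of_iso (.node (hp.cons s) (.cons (Iso.refl s) hm)))
    refine modifySum_forall₂ ?_ hf.node
    refine List.Forall₂.imp ?_ ((List.forall₂_and_left (p := fun a => a ∈ l) _ _).2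
      ⟨fun a ha => hp.mem_iff.2 ha, hm⟩)
    exact fun x y ⟨hx, hxy⟩ => ⟨mk_eq_of_iso hxy, rfl, fun _ => ih x hx hxy⟩

theorem size_node (l : List PlanarTree) : (node l).size = 1 + (l.map size).sum := by
  rw [size]
  simp

theorem ne_leaf_of_mem_graftList {s t u : PlanarTree} (h : u ∈ graftList s t) : u ≠ node [] := by
  obtain ⟨l⟩ := t
  rintro rfl
  have haux : ∀ k : List PlanarTree, [] ∉ graftAux s k := by
    rintro (_ | ⟨a, k⟩) <;> simp [graftAux]
  simp [graftList, haux] at h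

theorem sum_map_sum_comm {α β : Type*} (l : List α) (m : List β) (f : α → β → ℕ) :
    (l.map fun a => (m.map fun b => f a b).sum).sum =
      (m.map fun b => (l.map fun a => f a b).sum).sum := by
  simpa using Multiset.sum_map_sum_map (l : Multiset α) (m : Multiset β) (f := f)

theorem sum_pruneAux_graftAux {l : List PlanarTree}
    (h : ∀ a ∈ l, ∀ f : PlanarTree → ℕ,
      ((growList a).map fun u => ((pruneList u).map f).sum).sum =
        ((pruneList a).map fun u => ((growList u).map f).sum).sum + a.size * f a)
    (F : List PlanarTree → ℕ) :
    ((graftAux (node []) l).map fun m => ((pruneAux m).map F).sum).sum =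
      ((pruneAux l).map fun m => ((graftAux (node []) m).map F).sum).sum +
        (l.map size).sum * F l := by
  induction l generalizing F with
  | nil => simp [graftAux, pruneAux]
  | cons a l ih =>
    have ha := h a List.mem_cons_self fun x => F (x :: l)
    have hl := ih (fun b hb => h b (List.mem_cons_of_mem _ hb)) fun m => F (a :: m)
    have hprune : ∀ (b : PlanarTree) (m : List PlanarTree) (F : List PlanarTree → ℕ),
        ((pruneAux (b :: m)).map F).sum = (if b = node [] then 1 else 0) * F m +
          ((pruneList b).map fun x => F (x :: m)).sum +
          ((pruneAux m).map fun k => F (b :: k)).sum := by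
      intro b m F
      simp only [sum_pruneAux, modifySum]
    have hgraft : ∀ (b : PlanarTree) (m : List PlanarTree) (F : List PlanarTree → ℕ),
        ((graftAux (node []) (b :: m)).map F).sum =
          ((growList b).map fun x => F (x :: m)).sum +
          ((graftAux (node []) m).map fun k => F (b :: k)).sum := by
      intro b m F
      simp only [sum_graftAux, modifySum, growList]
      ring
    have hgrown : ((growList a).map fun x => (if x = node [] then 1 else 0) * F l +
          ((pruneList x).map fun y => F (y :: l)).sum +
          ((pruneAux l).map fun k => F (x :: k)).sum).sum =
        ((growList a).map fun x => ((pruneList x).map fun y => F (y :: l)).sum).sum +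
          ((growList a).map fun x => ((pruneAux l).map fun k => F (x :: k)).sum).sum := by
      rw [← List.sum_map_add]
      refine congrArg List.sum (List.map_congr_left fun x hx => ?_)
      rw [if_neg (ne_leaf_of_mem_graftList hx), zero_mul, zero_add]
    rw [hgraft, hprune]
    simp only [hprune, hgraft]
    rw [hgrown, ha]
    simp only [List.sum_map_add, List.sum_map_mul_left]
    rw [hl, sum_map_sum_comm (growList a), sum_map_sum_comm (graftAux (node []) l)]
    simp only [List.map_cons, List.sum_cons]
    ring

/-- Growing and then pruning is the same as pruning and then growing, up to `|t|` copies of `t`. -/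
theorem sum_pruneList_growList (t : PlanarTree) (f : PlanarTree → ℕ) :
    ((growList t).map fun u => ((pruneList u).map f).sum).sum =
      ((pruneList t).map fun u => ((growList u).map f).sum).sum + t.size * f t := by
  induction t using induction_on_branches generalizing f with
  | node l ih =>
    have hroot : ((pruneAux (node [] :: l)).map fun m => f (node m)).sum =
        f (node l) + ((pruneAux l).map fun m => f (node (node [] :: m))).sum := by
      simp [pruneList, pruneAux, Function.comp_def]
    rw [growList, sum_graftList_node, sum_pruneList_node, sum_pruneList_node]
    simp only [growList, sum_pruneList_node, sum_graftList_node]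
    rw [hroot, sum_pruneAux_graftAux ih fun m => f (node m), List.sum_map_add, size_node]
    ring

end PlanarTree

namespace RTree

open PlanarTree

theorem countP_eq_sum (T : RTree) (L : List PlanarTree) :
    (L.countP fun p => decide (mk p = T)) = (L.map fun p => if mk p = T then 1 else 0).sum := by
  induction L with
  | nil => rfl
  | cons a L ih => by_cases h : mk a = T <;> simp [h, ih, add_comm]

theorem treeInvariant_indicator (T : RTree) :
    TreeInvariant fun p => if mk p = T then 1 else 0 := by
  intro a b hab
  simp only [hab]

theorem mCov_mk (T : RTree) (p : PlanarTree) :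
    mCov T (mk p) = ((pruneList p).map fun q => if mk q = T then 1 else 0).sum := by
  rw [mCov, countP_eq_sum]
  exact apply_eq_of_mk_eq (φ := fun p => ((pruneList p).map fun q => if mk q = T then 1 else 0).sum)
    (fun _ _ h => h.sum_pruneList (treeInvariant_indicator T)) (Quotient.out_eq _)

theorem nCov_mk (p : PlanarTree) (T : RTree) :
    nCov (mk p) T = ((growList p).map fun q => if mk q = T then 1 else 0).sum := by
  rw [nCov, countP_eq_sum]
  exact apply_eq_of_mk_eq (φ := fun p => ((growList p).map fun q => if mk q = T then 1 else 0).sum)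
    (fun _ _ h => h.sum_graftList _ (treeInvariant_indicator T)) (Quotient.out_eq _)

theorem finsum_mem_countP_mul (L : List PlanarTree) (h : RTree → ℕ) {S : Set RTree}
    (hS : ∀ T ∉ S, (L.countP fun p => decide (mk p = T)) * h T = 0) :
    ∑ᶠ T ∈ S, ((L.countP fun p => decide (mk p = T)) * h T : ℤ) =
      ((L.map fun p => h (mk p)).sum : ℕ) := by
  have hcount : ∀ T, (L.countP fun p => decide (mk p = T)) = (L.map mk).count T := by
    intro T
    rw [List.count, List.countP_map]
    refine List.countP_congr fun p _ => ?_
    simp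
  have hS' : ∀ T ∉ S, ((L.countP fun p => decide (mk p = T)) * h T : ℤ) = 0 :=
    fun T hT => mod_cast hS T hT
  rw [finsum_mem_def, Set.indicator_eq_self.2 fun T hT => not_imp_comm.1 (hS' T) hT,
    finsum_eq_sum_of_support_subset (s := (L.map mk).toFinset)]
  · have hsum := Finset.sum_list_map_count (L.map mk) h
    simp only [List.map_map, Function.comp_def, smul_eq_mul] at hsum
    rw [hsum, Nat.cast_sum]
    exact Finset.sum_congr rfl fun T _ => by rw [hcount, Nat.cast_mul]
  · intro T hT
    rw [Function.mem_support, hcount] at hT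
    have hpos := left_ne_zero_of_mul hT
    rw [Nat.cast_ne_zero] at hpos
    simpa using List.count_pos_iff.1 (Nat.pos_of_ne_zero hpos)

theorem mCov_eq_zero {T T' : RTree} (h : ¬ Covers T T') : mCov T T' = 0 := by
  rw [mCov, List.countP_eq_zero]
  intro p hp hT
  exact h ⟨p, hp, of_decide_eq_true hT⟩

end RTree

/-- `Σ_{t ⊲ t'} n(t;t')m(t;t') - Σ_{t'' ⊲ t} n(t'';t)m(t'';t) = |t|`. -/
theorem stmt4 (t : RTree) :
    (∑ᶠ t' ∈ {t' : RTree | RTree.Covers t t'}, (RTree.nCov t t' * RTree.mCov t t' : ℤ))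
      - (∑ᶠ t'' ∈ {t'' : RTree | RTree.Covers t'' t}, (RTree.nCov t'' t * RTree.mCov t'' t : ℤ))
      = (t.size : ℤ) := by
  have hup : ∑ᶠ t' ∈ {t' : RTree | RTree.Covers t t'},
      (RTree.nCov t t' * RTree.mCov t t' : ℤ) = _ :=
    RTree.finsum_mem_countP_mul t.rep.growList (fun t' => RTree.mCov t t') fun t' ht' => by
      rw [RTree.mCov_eq_zero ht', mul_zero]
  have hdown : ∑ᶠ t'' ∈ {t'' : RTree | RTree.Covers t'' t},
      (RTree.nCov t'' t * RTree.mCov t'' t : ℤ) = _ :=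
    (finsum_mem_congr rfl fun _ _ => mul_comm _ _).trans <|
      RTree.finsum_mem_countP_mul t.rep.pruneList (fun t'' => RTree.nCov t'' t) fun t'' ht'' => by
        rw [← RTree.mCov, RTree.mCov_eq_zero ht'', zero_mul]
  have hcomm := t.rep.sum_pruneList_growList fun p => if RTree.mk p = t then 1 else 0
  rw [if_pos (show RTree.mk t.rep = t from Quotient.out_eq t), mul_one] at hcomm
  simp only [← RTree.mCov_mk, ← RTree.nCov_mk] at hcomm
  rw [hup, hdown, hcomm, Nat.cast_add, add_sub_cancel_left]
  rfl
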